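/- Let m ∈ ℝ, ρ > 0, δ ≥ 0, let Φ, Ψ be Schwartz functions on ℝⁿ, and let {a_{j,j′,k,k′}} (integers j, j′ ≥ 0, k, k′ ∈ ℤⁿ) be complex numbers such that for all nonnegative integers α, β there is a constant C_{α,β} with |a_{j,j′,k,k′}| ≤ C_{α,β} 2^{−(n/2+α)j} 2^{−(n/2+β)j′} (1+2^{−j′}|k′|)^{m + δα − ρβ} for all j, j′, k, k′. Then the series σ(x,ξ) = ∑_{j,j′,k,k′} a_{j,j′,k,k′} 2^{nj/2} Φ(2^j x − k) 2^{nj′/2} Ψ(2^{j′} ξ − k′) converges absolutely, together with all its termwise derivatives, to a smooth function σ on ℝⁿ × ℝⁿ, and σ ∈ S^m_{ρ,δ}: for all multi-indices α, β ∈ ℕⁿ there is C_{α,β} such that |∂_x^α ∂_ξ^β σ(x,ξ)| ≤ C_{α,β} (1+|ξ|)^{m + δ|α| − ρ|β|}. -/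

import Mathlib

open MeasureTheory Complex
open scoped RealInnerProductSpace ENNReal NNReal

noncomputable section

abbrev En (n : ℕ) : Type := EuclideanSpace ℝ (Fin n)

/-- Image of an integer vector `k ∈ ℤⁿ` in `ℝⁿ`. -/
def intVec (n : ℕ) (k : Fin n → ℤ) : En n :=
  (EuclideanSpace.equiv (Fin n) ℝ).symm fun i => (k i : ℝ)

/-- The unit coordinate vector `eᵢ` of `ℝⁿ`. -/
def unitE (n : ℕ) (i : Fin n) : En n := EuclideanSpace.single i 1

/-- Iterated directional (partial) derivative along the list of directions `L`. -/
def pdSeq {V : Type*} [NormedAddCommGroup V] [NormedSpace ℝ V] (L : List V) (f : V → ℂ) :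
    V → ℂ :=
  L.foldr (fun v g => fun x => fderiv ℝ g x v) f

/-- The list of directions encoding the multi-index `α`: direction `dir i` repeated `α i`
times. -/
def dirList {V : Type*} {n : ℕ} (α : Fin n → ℕ) (dir : Fin n → V) : List V :=
  (List.ofFn fun i => List.replicate (α i) (dir i)).flatten

/-- The mixed partial derivative `∂_x^α ∂_ξ^β σ` of a symbol `σ(x,ξ)` on `ℝⁿ × ℝⁿ`. -/
def mixD (n : ℕ) (α β : Fin n → ℕ) (σ : En n × En n → ℂ) : En n × En n → ℂ :=
  pdSeq (dirList α (fun i => (unitE n i, (0 : En n))) ++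
    dirList β (fun i => ((0 : En n), unitE n i))) σ

/-- The Hörmander class `S^m_{ρ,δ}`: `σ` is smooth and
`|∂_x^α ∂_ξ^β σ(x,ξ)| ≤ C_{α,β} (1+|ξ|)^{m − ρ|β| + δ|α|}`. -/
def IsHormander (n : ℕ) (m ρ δ : ℝ) (σ : En n × En n → ℂ) : Prop :=
  ContDiff ℝ (⊤ : ℕ∞) σ ∧
  ∀ α β : Fin n → ℕ, ∃ C : ℝ, ∀ x ξ : En n,
    ‖mixD n α β σ (x, ξ)‖ ≤
      C * (1 + ‖ξ‖) ^ (m - ρ * (∑ i, (β i : ℝ)) + δ * (∑ i, (α i : ℝ)))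

/-- The difference operator `Δ_h g(X) = g(X+h) − g(X)`. -/
def idiff {V : Type*} [Add V] (h : V) (g : V → ℂ) : V → ℂ := fun X => g (X + h) - g X

/-- The Besov `B^{α,∞}_∞` norm (valued in `ℝ≥0∞`):
`‖g‖_∞ + sup_{h≠0} |h|^{−α} ‖Δ_h^{α+1} g‖_∞`. -/
def besovE (n : ℕ) (α : ℕ) (g : En n → ℂ) : ℝ≥0∞ :=
  (⨆ x, (‖g x‖₊ : ℝ≥0∞)) +
    ⨆ (h : En n) (_ : h ≠ 0),
      ((‖h‖₊ : ℝ≥0∞) ^ (α : ℝ))⁻¹ * ⨆ x, (‖(idiff h)^[α + 1] g x‖₊ : ℝ≥0∞)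

/-- The partial derivative `∂_ξ^β σ` in the `ξ`-variables only. -/
def xiD (n : ℕ) (β : Fin n → ℕ) (σ : En n × En n → ℂ) : En n → En n → ℂ :=
  fun x => pdSeq (dirList β (unitE n)) (fun ξ => σ (x, ξ))

/-- The class `S̃^m_{ρ,δ}`: `σ(x,ξ)` is smooth in `ξ`, its `ξ`-derivatives are continuous,
and `‖∂_ξ^β σ(·,ξ)‖_{B^{α,∞}_∞} ≤ C_{α,β} (1+|ξ|)^{m − ρ|β| + δα}` (the Besov norm taken in
the `x`-variable). -/
def IsTilde (n : ℕ) (m ρ δ : ℝ) (σ : En n × En n → ℂ) : Prop :=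
  (∀ x : En n, ContDiff ℝ (⊤ : ℕ∞) fun ξ => σ (x, ξ)) ∧
  (∀ β : Fin n → ℕ, Continuous fun X : En n × En n => xiD n β σ X.1 X.2) ∧
  ∀ (β : Fin n → ℕ) (α : ℕ), ∃ C : ℝ, ∀ ξ : En n,
    besovE n α (fun x => xiD n β σ x ξ) ≤
      ENNReal.ofReal (C * (1 + ‖ξ‖) ^ (m - ρ * (∑ i, (β i : ℝ)) + δ * α))

/-- The term `a_{j,j′,k,k′} 2^{nj/2} Φ(2^j x − k) 2^{nj′/2} Ψ(2^{j′} ξ − k′)` of the wavelet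
series. -/
def wterm2 (n : ℕ) (Φ Ψ : SchwartzMap (En n) ℂ)
    (a : ℕ × ℕ × (Fin n → ℤ) × (Fin n → ℤ) → ℂ)
    (q : ℕ × ℕ × (Fin n → ℤ) × (Fin n → ℤ)) : En n × En n → ℂ :=
  fun X => a q * (((2 : ℝ) ^ ((n * q.1 : ℝ) / 2) : ℝ) : ℂ) *
    Φ ((2 : ℝ) ^ q.1 • X.1 - intVec n q.2.2.1) *
    (((2 : ℝ) ^ ((n * q.2.1 : ℝ) / 2) : ℝ) : ℂ) *
    Ψ ((2 : ℝ) ^ q.2.1 • X.2 - intVec n q.2.2.2)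

/-- polynomial decay weight -/
def pw (n M : ℕ) (y : En n) : ℝ := ((1 + ‖y‖) ^ M)⁻¹

lemma pw_nonneg (n M : ℕ) (y : En n) : 0 ≤ pw n M y := by unfold pw; positivity

lemma pw_sub_le (n M : ℕ) (u v : En n) : pw n M (u - v) ≤ (1 + ‖u‖) ^ M * pw n M v := by
  unfold pw
  have h : 1 + ‖v‖ ≤ (1 + ‖u‖) * (1 + ‖u - v‖) := by
    have h1 : ‖v‖ ≤ ‖u‖ + ‖u - v‖ := by
      calc ‖v‖ = ‖u - (u - v)‖ := by congr 1; abel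
        _ ≤ _ := norm_sub_le _ _
    nlinarith [norm_nonneg u, norm_nonneg (u - v)]
  have h2 : (1 + ‖v‖) ^ M ≤ (1 + ‖u‖) ^ M * (1 + ‖u - v‖) ^ M := by
    rw [← mul_pow]; gcongr
  rw [← div_eq_mul_inv, inv_eq_one_div, div_le_div_iff₀ (by positivity) (by positivity)]
  linarith

lemma exists_summable_pw (n : ℕ) : ∃ M : ℕ, Summable fun k : Fin n → ℤ => pw n M (intVec n k) := by
  classical
  let b := (EuclideanSpace.basisFun (Fin n) ℝ).toBasis
  let L : Submodule ℤ (En n) := Submodule.span ℤ (Set.range b)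
  have hmem : ∀ k : Fin n → ℤ, intVec n k ∈ L := by
    intro k
    have : intVec n k = ∑ i, k i • b i := by
      ext i
      simp [intVec, b, Finset.sum_apply, Pi.single_apply]
    rw [this]
    exact Submodule.sum_mem _ fun i _ => Submodule.smul_mem _ _ (Submodule.subset_span ⟨i, rfl⟩)
  let M := Module.finrank ℤ L + 1
  refine ⟨M, ?_⟩
  have hs := ZLattice.summable_norm_pow_inv L M (by simp [M])
  let e : (Fin n → ℤ) → L := fun k => ⟨intVec n k, hmem k⟩
  have he : Function.Injective e := by
    intro k k' h
    have h1 : intVec n k = intVec n k' := congrArg Subtype.val h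
    funext i
    have h2 := congrArg (fun v : En n => v i) h1
    simpa [intVec] using h2
  have hs2 := hs.comp_injective he
  refine Summable.of_norm_bounded_eventually hs2 ?_
  have : ∀ᶠ k : Fin n → ℤ in Filter.cofinite, k ≠ 0 := by
    simp
  filter_upwards [this] with k hk
  have hne : intVec n k ≠ 0 := by
    intro h
    apply hk
    apply he
    apply Subtype.ext
    show intVec n k = intVec n 0
    rw [h]; ext i; simp [intVec]
  have hpos : 0 < ‖intVec n k‖ := norm_pos_iff.mpr hne
  rw [Real.norm_of_nonneg (pw_nonneg _ _ _)]
  simp only [Function.comp, e, pw, ← inv_pow]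
  show _ ≤ ‖intVec n k‖⁻¹ ^ M
  gcongr
  linarith

/-- the index set -/
abbrev Ix (n : ℕ) : Type := ℕ × ℕ × (Fin n → ℤ) × (Fin n → ℤ)

/-- the summable majorant -/
def maj (n M : ℕ) (q : Ix n) : ℝ :=
  (1 / 2 : ℝ) ^ q.1 * ((1 / 2 : ℝ) ^ q.2.1 * (pw n M (intVec n q.2.2.1) * pw n M (intVec n q.2.2.2)))

lemma summable_maj (n M : ℕ) (h : Summable fun k : Fin n → ℤ => pw n M (intVec n k)) :
    Summable (maj n M) := by
  have hg : Summable fun j : ℕ => (1 / 2 : ℝ) ^ j := summable_geometric_two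
  have h1 := h.mul_of_nonneg h (fun _ => pw_nonneg _ _ _) (fun _ => pw_nonneg _ _ _)
  have h2 := hg.mul_of_nonneg h1 (fun _ => by positivity)
    (fun _ => mul_nonneg (pw_nonneg _ _ _) (pw_nonneg _ _ _))
  exact hg.mul_of_nonneg h2 (fun _ => by positivity)
    (fun _ => mul_nonneg (by positivity) (mul_nonneg (pw_nonneg _ _ _) (pw_nonneg _ _ _)))

lemma schwartz_decay (n M : ℕ) (Φ : SchwartzMap (En n) ℂ) : ∃ C : ℝ, 0 ≤ C ∧ ∀ y,
    ‖Φ y‖ ≤ C * pw n M y ∧ ‖fderiv ℝ Φ y‖ ≤ C * pw n M y := by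
  have h := fun (i : ℕ) (hi : i ≤ 1) y => SchwartzMap.one_add_le_sup_seminorm_apply (𝕜 := ℝ)
    (m := (M, 1)) (k := M) (n := i) le_rfl hi Φ y
  set C := 2 ^ (M, 1).1 * ((Finset.Iic (M, 1)).sup
    (fun m => SchwartzMap.seminorm ℝ m.1 m.2) : Seminorm ℝ (SchwartzMap (En n) ℂ)) Φ with hC
  refine ⟨C, ?_, fun y => ⟨?_, ?_⟩⟩
  · exact le_trans (by positivity) (h 0 (by simp) 0)
  · have := h 0 (by simp) y
    rw [norm_iteratedFDeriv_zero] at this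
    unfold pw
    rw [← div_eq_mul_inv, le_div_iff₀ (by positivity)]
    linarith
  · have := h 1 (by simp) y
    rw [norm_iteratedFDeriv_one] at this
    unfold pw
    rw [← div_eq_mul_inv, le_div_iff₀ (by positivity)]
    linarith

/-- rapidly decaying coefficients -/
def Nice (n : ℕ) (c : Ix n → ℂ) : Prop :=
  ∀ N : ℕ, ∃ C : ℝ, 0 ≤ C ∧ ∀ q, ‖c q‖ * ((2 : ℝ) ^ q.1) ^ N * ((2 : ℝ) ^ q.2.1) ^ N ≤ C

lemma Nice.mul1 {n : ℕ} {c : Ix n → ℂ} (h : Nice n c) : Nice n fun q => c q * 2 ^ q.1 := by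
  intro N
  obtain ⟨C, hC0, hC⟩ := h (N + 1)
  refine ⟨C, hC0, fun q => le_trans ?_ (hC q)⟩
  have h1 : (1 : ℝ) ≤ 2 ^ q.2.1 := one_le_pow₀ (by norm_num)
  have : ‖c q * 2 ^ q.1‖ = ‖c q‖ * 2 ^ q.1 := by simp
  rw [this, pow_succ, pow_succ]
  have : 0 ≤ ‖c q‖ * (((2 : ℝ) ^ q.1) ^ N * 2 ^ q.1) * ((2 : ℝ) ^ q.2.1) ^ N := by positivity
  nlinarith

lemma Nice.mul2 {n : ℕ} {c : Ix n → ℂ} (h : Nice n c) : Nice n fun q => c q * 2 ^ q.2.1 := by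
  intro N
  obtain ⟨C, hC0, hC⟩ := h (N + 1)
  refine ⟨C, hC0, fun q => le_trans ?_ (hC q)⟩
  have h1 : (1 : ℝ) ≤ 2 ^ q.1 := one_le_pow₀ (by norm_num)
  have : ‖c q * 2 ^ q.2.1‖ = ‖c q‖ * 2 ^ q.2.1 := by simp
  rw [this, pow_succ, pow_succ]
  have : 0 ≤ ‖c q‖ * ((2 : ℝ) ^ q.1) ^ N * (((2 : ℝ) ^ q.2.1) ^ N * 2 ^ q.2.1) := by positivity
  nlinarith

lemma local_bound (n M : ℕ) {c : Ix n → ℂ} (h : Nice n c) (R : ℝ) (hR : 0 ≤ R) :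
    ∃ K : ℝ, 0 ≤ K ∧ ∀ (q : Ix n) (X : En n × En n), ‖X‖ ≤ R →
      ‖c q‖ * 2 ^ q.1 * 2 ^ q.2.1 * (pw n M ((2 : ℝ) ^ q.1 • X.1 - intVec n q.2.2.1) *
        pw n M ((2 : ℝ) ^ q.2.1 • X.2 - intVec n q.2.2.2)) ≤ K * maj n M q := by
  obtain ⟨C, hC0, hC⟩ := h (M + 2)
  refine ⟨C * ((1 + R) ^ M * (1 + R) ^ M), by positivity, fun q X hX => ?_⟩
  have key : ∀ (j : ℕ) (x : En n) (v : En n), ‖x‖ ≤ R →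
      pw n M ((2 : ℝ) ^ j • x - v) ≤ ((2 : ℝ) ^ j) ^ M * (1 + R) ^ M * pw n M v := by
    intro j x v hx
    refine (pw_sub_le n M _ v).trans ?_
    refine mul_le_mul_of_nonneg_right ?_ (pw_nonneg _ _ _)
    rw [← mul_pow]
    gcongr
    rw [norm_smul]
    have h1 : (1 : ℝ) ≤ 2 ^ j := one_le_pow₀ (by norm_num)
    rw [Real.norm_of_nonneg (by positivity)]
    nlinarith [norm_nonneg x]
  have k1 := key q.1 X.1 (intVec n q.2.2.1) ((norm_fst_le X).trans hX)
  have k2 := key q.2.1 X.2 (intVec n q.2.2.2) ((norm_snd_le X).trans hX)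
  have hq := hC q
  have p1 := pw_nonneg n M (intVec n q.2.2.1)
  have p2 := pw_nonneg n M (intVec n q.2.2.2)
  unfold maj
  set a := (2 : ℝ) ^ q.1 with ha
  set b := (2 : ℝ) ^ q.2.1 with hb
  have ha0 : 0 < a := by positivity
  have hb0 : 0 < b := by positivity
  have ea : (1 / 2 : ℝ) ^ q.1 = a⁻¹ := by rw [ha, one_div, inv_pow]
  have eb : (1 / 2 : ℝ) ^ q.2.1 = b⁻¹ := by rw [hb, one_div, inv_pow]
  rw [ea, eb]
  calc _ ≤ ‖c q‖ * a * b * ((a ^ M * (1 + R) ^ M * pw n M (intVec n q.2.2.1)) *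
        (b ^ M * (1 + R) ^ M * pw n M (intVec n q.2.2.2))) := by
        gcongr
        exact pw_nonneg _ _ _
    _ = (‖c q‖ * a ^ (M + 2) * b ^ (M + 2)) * (((1 + R) ^ M * (1 + R) ^ M) *
        (a⁻¹ * (b⁻¹ * (pw n M (intVec n q.2.2.1) * pw n M (intVec n q.2.2.2))))) := by
        field_simp
        ring
    _ ≤ C * (((1 + R) ^ M * (1 + R) ^ M) *
        (a⁻¹ * (b⁻¹ * (pw n M (intVec n q.2.2.1) * pw n M (intVec n q.2.2.2))))) := by
        gcongr
    _ = _ := by ring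

/-- single term -/
def TT (n : ℕ) (c : Ix n → ℂ) (Φ Ψ : SchwartzMap (En n) ℂ) (q : Ix n) : En n × En n → ℂ :=
  fun X => c q * (Φ ((2 : ℝ) ^ q.1 • X.1 - intVec n q.2.2.1) *
    Ψ ((2 : ℝ) ^ q.2.1 • X.2 - intVec n q.2.2.2))

/-- the sum -/
def SS (n : ℕ) (c : Ix n → ℂ) (Φ Ψ : SchwartzMap (En n) ℂ) : En n × En n → ℂ :=
  fun X => ∑' q, TT n c Φ Ψ q X

/-- directional derivative -/
def dS {n : ℕ} (v : En n) (Φ : SchwartzMap (En n) ℂ) : SchwartzMap (En n) ℂ :=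
  SchwartzMap.evalCLM ℝ (En n) ℂ v (SchwartzMap.fderivCLM ℝ (En n) ℂ Φ)

lemma dS_apply {n : ℕ} (v : En n) (Φ : SchwartzMap (En n) ℂ) (y : En n) :
    dS v Φ y = fderiv ℝ Φ y v := rfl

/-- derivative of a term -/
def TT' (n : ℕ) (c : Ix n → ℂ) (Φ Ψ : SchwartzMap (En n) ℂ) (q : Ix n) (X : En n × En n) :
    En n × En n →L[ℝ] ℂ :=
  c q • ((Φ ((2 : ℝ) ^ q.1 • X.1 - intVec n q.2.2.1)) •
      ((fderiv ℝ Ψ ((2 : ℝ) ^ q.2.1 • X.2 - intVec n q.2.2.2)).comp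
        ((2 : ℝ) ^ q.2.1 • ContinuousLinearMap.snd ℝ (En n) (En n))) +
    (Ψ ((2 : ℝ) ^ q.2.1 • X.2 - intVec n q.2.2.2)) •
      ((fderiv ℝ Φ ((2 : ℝ) ^ q.1 • X.1 - intVec n q.2.2.1)).comp
        ((2 : ℝ) ^ q.1 • ContinuousLinearMap.fst ℝ (En n) (En n))))

lemma hasFDerivAt_TT (n : ℕ) (c : Ix n → ℂ) (Φ Ψ : SchwartzMap (En n) ℂ) (q : Ix n)
    (X : En n × En n) : HasFDerivAt (TT n c Φ Ψ q) (TT' n c Φ Ψ q X) X := by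
  have h1 : HasFDerivAt (fun X : En n × En n => (2 : ℝ) ^ q.1 • X.1 - intVec n q.2.2.1)
      ((2 : ℝ) ^ q.1 • ContinuousLinearMap.fst ℝ (En n) (En n)) X :=
    ((2 : ℝ) ^ q.1 • ContinuousLinearMap.fst ℝ (En n) (En n)).hasFDerivAt.sub_const _
  have h2 : HasFDerivAt (fun X : En n × En n => (2 : ℝ) ^ q.2.1 • X.2 - intVec n q.2.2.2)
      ((2 : ℝ) ^ q.2.1 • ContinuousLinearMap.snd ℝ (En n) (En n)) X :=
    ((2 : ℝ) ^ q.2.1 • ContinuousLinearMap.snd ℝ (En n) (En n)).hasFDerivAt.sub_const _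
  have g1 := (Φ.differentiableAt (x := (2 : ℝ) ^ q.1 • X.1 - intVec n q.2.2.1)).hasFDerivAt.comp X h1
  have g2 := (Ψ.differentiableAt
    (x := (2 : ℝ) ^ q.2.1 • X.2 - intVec n q.2.2.2)).hasFDerivAt.comp X h2
  exact (g1.mul g2).const_mul (c q)

lemma TT'_apply (n : ℕ) (c : Ix n → ℂ) (Φ Ψ : SchwartzMap (En n) ℂ) (q : Ix n)
    (X : En n × En n) (v : En n × En n) : TT' n c Φ Ψ q X v =
      TT n (fun q => c q * 2 ^ q.1) (dS v.1 Φ) Ψ q X +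
      TT n (fun q => c q * 2 ^ q.2.1) Φ (dS v.2 Ψ) q X := by
  simp [TT', TT, dS_apply]
  ring

lemma TT_bound (n M : ℕ) {c : Ix n → ℂ} (hc : Nice n c) (Φ Ψ : SchwartzMap (En n) ℂ)
    (R : ℝ) (hR : 0 ≤ R) : ∃ K : ℝ, ∀ (q : Ix n) (X : En n × En n), ‖X‖ ≤ R →
      ‖TT n c Φ Ψ q X‖ ≤ K * maj n M q ∧ ‖TT' n c Φ Ψ q X‖ ≤ K * maj n M q := by
  obtain ⟨K, hK0, hK⟩ := local_bound n M hc R hR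
  obtain ⟨C1, hC1, hΦ⟩ := schwartz_decay n M Φ
  obtain ⟨C2, hC2, hΨ⟩ := schwartz_decay n M Ψ
  refine ⟨2 * (C1 * C2) * K, fun q X hX => ?_⟩
  have hb := hK q X hX
  have hm : 0 ≤ maj n M q := by
    unfold maj
    have p1 := pw_nonneg n M (intVec n q.2.2.1)
    have p2 := pw_nonneg n M (intVec n q.2.2.2)
    positivity
  unfold TT TT'
  set y := (2 : ℝ) ^ q.1 • X.1 - intVec n q.2.2.1
  set z := (2 : ℝ) ^ q.2.1 • X.2 - intVec n q.2.2.2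
  have p1 := pw_nonneg n M y
  have p2 := pw_nonneg n M z
  obtain ⟨a1, a2⟩ := hΦ y
  obtain ⟨b1, b2⟩ := hΨ z
  have ha : (1 : ℝ) ≤ 2 ^ q.1 := one_le_pow₀ (by norm_num)
  have hb' : (1 : ℝ) ≤ 2 ^ q.2.1 := one_le_pow₀ (by norm_num)
  set a := (2 : ℝ) ^ q.1
  set b := (2 : ℝ) ^ q.2.1
  have hab : a ≤ a * b := le_mul_of_one_le_right (by linarith) hb'
  have hba : b ≤ a * b := le_mul_of_one_le_left (by linarith) ha
  have h1ab : 1 ≤ a * b := ha.trans hab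
  have fin : ‖c q‖ * (a * b) * ((C1 * pw n M y) * (C2 * pw n M z)) ≤ C1 * C2 * K * maj n M q := by
    calc _ = C1 * C2 * (‖c q‖ * a * b * (pw n M y * pw n M z)) := by ring
      _ ≤ C1 * C2 * (K * maj n M q) := by gcongr
      _ = _ := by ring
  have n1 : ‖(2 : ℝ) ^ q.1 • ContinuousLinearMap.fst ℝ (En n) (En n)‖ ≤ a := by
    rw [norm_smul, Real.norm_of_nonneg (by positivity)]
    exact mul_le_of_le_one_right (by positivity) (ContinuousLinearMap.norm_fst_le ..)
  have n2 : ‖(2 : ℝ) ^ q.2.1 • ContinuousLinearMap.snd ℝ (En n) (En n)‖ ≤ b := by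
    rw [norm_smul, Real.norm_of_nonneg (by positivity)]
    exact mul_le_of_le_one_right (by positivity) (ContinuousLinearMap.norm_snd_le ..)
  constructor
  · rw [norm_mul, norm_mul]
    calc ‖c q‖ * (‖Φ y‖ * ‖Ψ z‖) ≤ ‖c q‖ * ((C1 * pw n M y) * (C2 * pw n M z)) := by gcongr
      _ = ‖c q‖ * 1 * ((C1 * pw n M y) * (C2 * pw n M z)) := by ring
      _ ≤ ‖c q‖ * (a * b) * ((C1 * pw n M y) * (C2 * pw n M z)) := by gcongr
      _ ≤ C1 * C2 * K * maj n M q := fin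
      _ ≤ _ := by nlinarith [mul_nonneg (mul_nonneg (mul_nonneg hC1 hC2) hK0) hm]
  · rw [norm_smul]
    refine (mul_le_mul_of_nonneg_left (norm_add_le _ _) (norm_nonneg _)).trans ?_
    rw [norm_smul, norm_smul]
    have c1 := (ContinuousLinearMap.opNorm_comp_le (fderiv ℝ Ψ z)
      ((2 : ℝ) ^ q.2.1 • ContinuousLinearMap.snd ℝ (En n) (En n))).trans
      (mul_le_mul b2 n2 (norm_nonneg _) (by positivity))
    have c2 := (ContinuousLinearMap.opNorm_comp_le (fderiv ℝ Φ y)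
      ((2 : ℝ) ^ q.1 • ContinuousLinearMap.fst ℝ (En n) (En n))).trans
      (mul_le_mul a2 n1 (norm_nonneg _) (by positivity))
    calc _ ≤ ‖c q‖ * ((C1 * pw n M y) * (C2 * pw n M z * b) +
          (C2 * pw n M z) * (C1 * pw n M y * a)) := by gcongr
      _ = ‖c q‖ * b * ((C1 * pw n M y) * (C2 * pw n M z)) +
          ‖c q‖ * a * ((C1 * pw n M y) * (C2 * pw n M z)) := by ring
      _ ≤ ‖c q‖ * (a * b) * ((C1 * pw n M y) * (C2 * pw n M z)) +
          ‖c q‖ * (a * b) * ((C1 * pw n M y) * (C2 * pw n M z)) := by gcongr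
      _ ≤ _ := by linarith

lemma summable_TT_norm (n : ℕ) {c : Ix n → ℂ} (hc : Nice n c) (Φ Ψ : SchwartzMap (En n) ℂ)
    (X : En n × En n) : Summable fun q => ‖TT n c Φ Ψ q X‖ := by
  obtain ⟨M, hM⟩ := exists_summable_pw n
  obtain ⟨K, hK⟩ := TT_bound n M hc Φ Ψ ‖X‖ (norm_nonneg _)
  exact Summable.of_nonneg_of_le (fun _ => norm_nonneg _) (fun q => (hK q X le_rfl).1)
    ((summable_maj n M hM).mul_left K)

lemma hasFDerivAt_SS (n : ℕ) {c : Ix n → ℂ} (hc : Nice n c) (Φ Ψ : SchwartzMap (En n) ℂ)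
    (X : En n × En n) : HasFDerivAt (SS n c Φ Ψ) (∑' q, TT' n c Φ Ψ q X) X ∧
      Summable fun q => TT' n c Φ Ψ q X := by
  obtain ⟨M, hM⟩ := exists_summable_pw n
  obtain ⟨K, hK⟩ := TT_bound n M hc Φ Ψ (‖X‖ + 1) (by positivity)
  have hu := (summable_maj n M hM).mul_left K
  constructor
  · refine hasFDerivAt_tsum_of_isPreconnected (s := Metric.ball 0 (‖X‖ + 1)) (x₀ := X) hu
      Metric.isOpen_ball (convex_ball _ _).isPreconnected
      (fun q Y _ => hasFDerivAt_TT n c Φ Ψ q Y) (fun q Y hY => (hK q Y ?_).2) (by simp)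
      (summable_TT_norm n hc Φ Ψ X).of_norm (by simp)
    exact (mem_ball_zero_iff.mp hY).le
  · exact Summable.of_norm_bounded hu fun q => (hK q X (by linarith)).2

lemma fderiv_SS (n : ℕ) {c : Ix n → ℂ} (hc : Nice n c) (Φ Ψ : SchwartzMap (En n) ℂ)
    (X v : En n × En n) : fderiv ℝ (SS n c Φ Ψ) X v =
      SS n (fun q => c q * 2 ^ q.1) (dS v.1 Φ) Ψ X +
      SS n (fun q => c q * 2 ^ q.2.1) Φ (dS v.2 Ψ) X := by
  obtain ⟨h1, h2⟩ := hasFDerivAt_SS n hc Φ Ψ X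
  have h3 := (ContinuousLinearMap.apply ℝ ℂ v).map_tsum h2
  simp only [ContinuousLinearMap.apply_apply] at h3
  rw [h1.fderiv, h3]
  simp_rw [TT'_apply]
  exact (summable_TT_norm n hc.mul1 _ _ X).of_norm.tsum_add
    (summable_TT_norm n hc.mul2 _ _ X).of_norm

lemma contDiff_SS (n : ℕ) (N : ℕ) : ∀ {c : Ix n → ℂ} (_ : Nice n c)
    (Φ Ψ : SchwartzMap (En n) ℂ), ContDiff ℝ N (SS n c Φ Ψ) := by
  induction N with
  | zero =>
    intro c hc Φ Ψ
    exact contDiff_zero.mpr (continuous_iff_continuousAt.mpr fun X =>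
      (hasFDerivAt_SS n hc Φ Ψ X).1.continuousAt)
  | succ N ih =>
    intro c hc Φ Ψ
    push_cast
    rw [contDiff_succ_iff_fderiv_apply]
    refine ⟨fun X => (hasFDerivAt_SS n hc Φ Ψ X).1.differentiableAt, by simp, fun v => ?_⟩
    simp_rw [fderiv_SS n hc Φ Ψ]
    exact (ih hc.mul1 _ _).add (ih hc.mul2 _ _)

lemma dS_zero {n : ℕ} (Φ : SchwartzMap (En n) ℂ) : dS 0 Φ = 0 := by
  ext y; simp [dS_apply]

/-- iterated -/
def dL {n : ℕ} (L : List (En n)) (Φ : SchwartzMap (En n) ℂ) : SchwartzMap (En n) ℂ :=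
  L.foldr dS Φ

lemma TT_zero_left (n : ℕ) (c : Ix n → ℂ) (Ψ : SchwartzMap (En n) ℂ) (q : Ix n) (X) :
    TT n c 0 Ψ q X = 0 := by simp [TT]

lemma TT_zero_right (n : ℕ) (c : Ix n → ℂ) (Φ : SchwartzMap (En n) ℂ) (q : Ix n) (X) :
    TT n c Φ 0 q X = 0 := by simp [TT]

/-- coefficients after differentiation -/
def cc (n : ℕ) (c : Ix n → ℂ) (a b : ℕ) : Ix n → ℂ := fun q => c q * (2 ^ q.1) ^ a * (2 ^ q.2.1) ^ b

lemma cc_mul1 (n : ℕ) (c : Ix n → ℂ) (a b : ℕ) :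
    (fun q => cc n c a b q * 2 ^ q.1) = cc n c (a + 1) b := by
  funext q; simp only [cc]; ring

lemma cc_mul2 (n : ℕ) (c : Ix n → ℂ) (a b : ℕ) :
    (fun q => cc n c a b q * 2 ^ q.2.1) = cc n c a (b + 1) := by
  funext q; simp only [cc]; ring

lemma cc_zero (n : ℕ) (c : Ix n → ℂ) : cc n c 0 0 = c := by
  funext q; simp [cc]

lemma nice_cc (n : ℕ) {c : Ix n → ℂ} (hc : Nice n c) (a b : ℕ) : Nice n (cc n c a b) := by
  induction a with
  | zero =>
    induction b with
    | zero => rw [cc_zero]; exact hc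
    | succ b ih => rw [← cc_mul2]; exact ih.mul2
  | succ a ih => rw [← cc_mul1]; exact ih.mul1

lemma pdSeq_append {V : Type*} [NormedAddCommGroup V] [NormedSpace ℝ V] (L L' : List V)
    (f : V → ℂ) : pdSeq (L ++ L') f = pdSeq L (pdSeq L' f) := by
  simp [pdSeq]

lemma pdSeq_cons {V : Type*} [NormedAddCommGroup V] [NormedSpace ℝ V] (v : V) (L : List V)
    (f : V → ℂ) : pdSeq (v :: L) f = fun x => fderiv ℝ (pdSeq L f) x v := rfl

/-- abstract form of the iteration, used for both terms and sums -/
lemma pdSeq_general (n : ℕ) (c : Ix n → ℂ)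
    (F : (Ix n → ℂ) → SchwartzMap (En n) ℂ → SchwartzMap (En n) ℂ → En n × En n → ℂ)
    (h1 : ∀ a b v Φ Ψ, (fun X => fderiv ℝ (F (cc n c a b) Φ Ψ) X (v, 0)) =
      F (cc n c (a + 1) b) (dS v Φ) Ψ)
    (h2 : ∀ a b v Φ Ψ, (fun X => fderiv ℝ (F (cc n c a b) Φ Ψ) X (0, v)) =
      F (cc n c a (b + 1)) Φ (dS v Ψ)) (L L' : List (En n)) (Φ Ψ : SchwartzMap (En n) ℂ) :
    pdSeq (L.map (fun v => (v, (0 : En n))) ++ L'.map (fun v => ((0 : En n), v)))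
      (F (cc n c 0 0) Φ Ψ) = F (cc n c L.length L'.length) (dL L Φ) (dL L' Ψ) := by
  rw [pdSeq_append]
  have hB : pdSeq (L'.map (fun v => ((0 : En n), v))) (F (cc n c 0 0) Φ Ψ) =
      F (cc n c 0 L'.length) Φ (dL L' Ψ) := by
    induction L' with
    | nil => rfl
    | cons v L' ih => rw [List.map_cons, pdSeq_cons, ih, h2]; rfl
  rw [hB]
  induction L with
  | nil => rfl
  | cons v L ih => rw [List.map_cons, pdSeq_cons, ih, h1]; rfl

lemma pdSeq_TT (n : ℕ) (c : Ix n → ℂ) (q : Ix n) (L L' : List (En n))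
    (Φ Ψ : SchwartzMap (En n) ℂ) :
    pdSeq (L.map (fun v => (v, (0 : En n))) ++ L'.map (fun v => ((0 : En n), v)))
      (TT n (cc n c 0 0) Φ Ψ q) = TT n (cc n c L.length L'.length) (dL L Φ) (dL L' Ψ) q := by
  refine pdSeq_general n c (fun c Φ Ψ => TT n c Φ Ψ q) ?_ ?_ L L' Φ Ψ
  · intro a b v Φ Ψ
    funext X
    rw [(hasFDerivAt_TT _ _ _ _ _ _).fderiv, TT'_apply, cc_mul1]
    simp [dS_zero, TT_zero_right]
  · intro a b v Φ Ψ
    funext X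
    rw [(hasFDerivAt_TT _ _ _ _ _ _).fderiv, TT'_apply, cc_mul2]
    simp [dS_zero, TT_zero_left]

lemma pdSeq_SS (n : ℕ) {c : Ix n → ℂ} (hc : Nice n c) (L L' : List (En n))
    (Φ Ψ : SchwartzMap (En n) ℂ) :
    pdSeq (L.map (fun v => (v, (0 : En n))) ++ L'.map (fun v => ((0 : En n), v)))
      (SS n (cc n c 0 0) Φ Ψ) = SS n (cc n c L.length L'.length) (dL L Φ) (dL L' Ψ) := by
  refine pdSeq_general n c (fun c Φ Ψ => SS n c Φ Ψ) ?_ ?_ L L' Φ Ψ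
  · intro a b v Φ Ψ
    funext X
    rw [fderiv_SS n (nice_cc n hc a b), cc_mul1]
    simp [dS_zero, SS, TT_zero_right]
  · intro a b v Φ Ψ
    funext X
    rw [fderiv_SS n (nice_cc n hc a b), cc_mul2]
    simp [dS_zero, SS, TT_zero_left]

lemma dirList_map {V W : Type*} {n : ℕ} (α : Fin n → ℕ) (dir : Fin n → V) (f : V → W) :
    dirList α (fun i => f (dir i)) = (dirList α dir).map f := by
  simp [dirList, List.map_flatten, List.map_ofFn, Function.comp_def]

lemma dirList_length {V : Type*} {n : ℕ} (α : Fin n → ℕ) (dir : Fin n → V) :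
    (dirList α dir).length = ∑ i, α i := by
  simp [dirList, List.length_flatten, List.map_ofFn, Function.comp_def, List.sum_ofFn]

lemma peetre_real (x y t s : ℝ) (L : ℕ) (hx : 1 ≤ x) (hy : 1 ≤ y) (ht : 1 ≤ t)
    (h1 : x ≤ y * t) (h2 : y ≤ x * t) (hL : |s| ≤ L) : x ^ s ≤ y ^ s * t ^ L := by
  have hx0 : 0 < x := by linarith
  have hy0 : 0 < y := by linarith
  have ht0 : 0 < t := by linarith
  rw [← Real.rpow_natCast t L]
  rcases le_or_gt 0 s with hs | hs
  · calc x ^ s ≤ (y * t) ^ s := Real.rpow_le_rpow hx0.le h1 hs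
      _ = y ^ s * t ^ s := Real.mul_rpow hy0.le ht0.le
      _ ≤ _ := by
        gcongr
        exact (le_abs_self s).trans hL
  · have h3 : y / t ≤ x := by rw [div_le_iff₀ ht0]; exact h2
    calc x ^ s ≤ (y / t) ^ s := Real.rpow_le_rpow_of_nonpos (by positivity) h3 hs.le
      _ = y ^ s * t ^ (-s) := by
        rw [Real.div_rpow hy0.le ht0.le, Real.rpow_neg ht0.le, div_eq_mul_inv]
      _ ≤ _ := by
        gcongr
        exact (neg_le_abs s).trans hL

/-- the weight -/
def WW (n : ℕ) (q : Ix n) : ℝ := 1 + ((2 : ℝ) ^ q.2.1)⁻¹ * ‖intVec n q.2.2.2‖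

lemma WW_one_le (n : ℕ) (q : Ix n) : 1 ≤ WW n q := by
  unfold WW
  have : 0 ≤ ((2 : ℝ) ^ q.2.1)⁻¹ * ‖intVec n q.2.2.2‖ := by positivity
  linarith

lemma peetre_WW (n : ℕ) (q : Ix n) (ξ : En n) (s : ℝ) (L : ℕ) (hL : |s| ≤ L) :
    WW n q ^ s ≤ (1 + ‖ξ‖) ^ s * (1 + ‖(2 : ℝ) ^ q.2.1 • ξ - intVec n q.2.2.2‖) ^ L := by
  set z := (2 : ℝ) ^ q.2.1 • ξ - intVec n q.2.2.2 with hz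
  have hb : (1 : ℝ) ≤ 2 ^ q.2.1 := one_le_pow₀ (by norm_num)
  set b := (2 : ℝ) ^ q.2.1 with hbdef
  have hb0 : 0 < b := by linarith
  have e1 : b⁻¹ • intVec n q.2.2.2 = ξ - b⁻¹ • z := by
    rw [hz, smul_sub, smul_smul, inv_mul_cancel₀ hb0.ne', one_smul]; abel
  have e2 : ‖b⁻¹ • intVec n q.2.2.2‖ = b⁻¹ * ‖intVec n q.2.2.2‖ := by
    rw [norm_smul, Real.norm_of_nonneg (by positivity)]
  have e3 : ‖b⁻¹ • z‖ ≤ ‖z‖ := by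
    rw [norm_smul, Real.norm_of_nonneg (by positivity)]
    exact mul_le_of_le_one_left (norm_nonneg _) (inv_le_one_of_one_le₀ hb)
  have hW : WW n q = 1 + ‖b⁻¹ • intVec n q.2.2.2‖ := by rw [e2]; rfl
  have f1 : ‖b⁻¹ • intVec n q.2.2.2‖ ≤ ‖ξ‖ + ‖b⁻¹ • z‖ := by rw [e1]; exact norm_sub_le _ _
  have f2 : ‖ξ‖ ≤ ‖b⁻¹ • intVec n q.2.2.2‖ + ‖b⁻¹ • z‖ := by
    have : ξ = b⁻¹ • intVec n q.2.2.2 + b⁻¹ • z := by rw [e1]; abel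
    calc ‖ξ‖ = ‖b⁻¹ • intVec n q.2.2.2 + b⁻¹ • z‖ := by rw [← this]
      _ ≤ _ := norm_add_le _ _
  have g1 := norm_nonneg ξ
  have g2 := norm_nonneg z
  have g3 := norm_nonneg (b⁻¹ • intVec n q.2.2.2)
  refine peetre_real _ _ _ _ _ (WW_one_le n q) (by linarith) (by linarith) ?_ ?_ hL
  · rw [hW]; nlinarith
  · rw [hW]; nlinarith

/-- integer part -/
def flv (n : ℕ) (y : En n) : Fin n → ℤ := fun i => ⌊y i⌋

lemma norm_sub_flv (n : ℕ) (y : En n) : ‖y - intVec n (flv n y)‖ ≤ n := by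
  rw [EuclideanSpace.norm_eq]
  refine Real.sqrt_le_iff.mpr ⟨by positivity, ?_⟩
  calc ∑ i, ‖(y - intVec n (flv n y)) i‖ ^ 2 ≤ ∑ _i : Fin n, (1 : ℝ) := by
        refine Finset.sum_le_sum fun i _ => ?_
        have : (y - intVec n (flv n y)) i = Int.fract (y i) := by simp [intVec, flv]
        rw [this, Real.norm_of_nonneg (Int.fract_nonneg _)]
        exact pow_le_one₀ (Int.fract_nonneg _) (Int.fract_lt_one _).le
    _ = n := by simp
    _ ≤ (n : ℝ) ^ 2 := by
        have : n ≤ n ^ 2 := Nat.le_self_pow (by norm_num) n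
        exact_mod_cast this

lemma pw_shift (n M : ℕ) (y : En n) (k : Fin n → ℤ) :
    pw n M (y - intVec n (k + flv n y)) ≤ (1 + (n : ℝ)) ^ M * pw n M (intVec n k) := by
  have : y - intVec n (k + flv n y) = (y - intVec n (flv n y)) - intVec n k := by
    ext i; simp [intVec]; ring
  rw [this]
  refine (pw_sub_le _ _ _ _).trans ?_
  refine mul_le_mul_of_nonneg_right ?_ (pw_nonneg _ _ _)
  gcongr
  exact norm_sub_flv n y

/-- index shift -/
def shiftE (n : ℕ) (X : En n × En n) : Ix n ≃ Ix n where
  toFun q := (q.1, q.2.1, q.2.2.1 + flv n ((2 : ℝ) ^ q.1 • X.1),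
    q.2.2.2 + flv n ((2 : ℝ) ^ q.2.1 • X.2))
  invFun q := (q.1, q.2.1, q.2.2.1 - flv n ((2 : ℝ) ^ q.1 • X.1),
    q.2.2.2 - flv n ((2 : ℝ) ^ q.2.1 • X.2))
  left_inv q := by simp
  right_inv q := by simp

lemma pw_add (n M L : ℕ) (z : En n) : (1 + ‖z‖) ^ L * pw n (M + L) z = pw n M z := by
  unfold pw
  have : (1 + ‖z‖) ≠ 0 := by positivity
  rw [pow_add]; field_simp

lemma global_bound (n : ℕ) (c : Ix n → ℂ) (Φ Ψ : SchwartzMap (En n) ℂ) (C s : ℝ) (hC0 : 0 ≤ C)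
    (hC : ∀ q, ‖c q‖ * 2 ^ q.1 * 2 ^ q.2.1 ≤ C * WW n q ^ s) :
    ∃ K : ℝ, ∀ x ξ, ‖SS n c Φ Ψ (x, ξ)‖ ≤ K * (1 + ‖ξ‖) ^ s := by
  obtain ⟨M, hM⟩ := exists_summable_pw n
  obtain ⟨L, hL⟩ := exists_nat_ge |s|
  obtain ⟨C1, hC1, hΦ⟩ := schwartz_decay n M Φ
  obtain ⟨C2, hC2, hΨ⟩ := schwartz_decay n (M + L) Ψ
  have hsm := summable_maj n M hM
  refine ⟨C * C1 * C2 * ((1 + (n : ℝ)) ^ M * (1 + (n : ℝ)) ^ M) * ∑' q, maj n M q,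
    fun x ξ => ?_⟩
  unfold SS
  rw [← (shiftE n (x, ξ)).tsum_eq]
  have hs := (hsm.hasSum).mul_left
    (C * C1 * C2 * ((1 + (n : ℝ)) ^ M * (1 + (n : ℝ)) ^ M) * (1 + ‖ξ‖) ^ s)
  refine (tsum_of_norm_bounded hs ?_).trans_eq (by ring)
  intro q
  have k1 := pw_shift n M ((2 : ℝ) ^ q.1 • x) q.2.2.1
  have k2 := pw_shift n M ((2 : ℝ) ^ q.2.1 • ξ) q.2.2.2
  have hq := hC (shiftE n (x, ξ) q)
  have hp := peetre_WW n (shiftE n (x, ξ) q) ξ s L hL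
  set r := shiftE n (x, ξ) q with hr
  have r1 : r.1 = q.1 := rfl
  have r2 : r.2.1 = q.2.1 := rfl
  change pw n M ((2 : ℝ) ^ r.1 • x - intVec n r.2.2.1) ≤ _ at k1
  change pw n M ((2 : ℝ) ^ r.2.1 • ξ - intVec n r.2.2.2) ≤ _ at k2
  have a1 := (hΦ ((2 : ℝ) ^ r.1 • x - intVec n r.2.2.1)).1
  have b1 := (hΨ ((2 : ℝ) ^ r.2.1 • ξ - intVec n r.2.2.2)).1
  simp only [TT, norm_mul, maj]
  rw [← r1, ← r2]
  set y := (2 : ℝ) ^ r.1 • x - intVec n r.2.2.1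
  set z := (2 : ℝ) ^ r.2.1 • ξ - intVec n r.2.2.2
  have p1 := pw_nonneg n M y
  have p2 := pw_nonneg n M z
  have p3 := pw_nonneg n (M + L) z
  have hw : 0 ≤ WW n r ^ s := Real.rpow_nonneg (zero_le_one.trans (WW_one_le n r)) s
  have ea : (1 / 2 : ℝ) ^ r.1 = ((2 : ℝ) ^ r.1)⁻¹ := by rw [one_div, inv_pow]
  have eb : (1 / 2 : ℝ) ^ r.2.1 = ((2 : ℝ) ^ r.2.1)⁻¹ := by rw [one_div, inv_pow]
  rw [ea, eb]
  set a := (2 : ℝ) ^ r.1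
  set b := (2 : ℝ) ^ r.2.1
  have ha0 : 0 < a := by positivity
  have hb0 : 0 < b := by positivity
  have hc : ‖c r‖ ≤ C * WW n r ^ s * (a⁻¹ * b⁻¹) := by
    rw [← mul_inv, ← div_eq_mul_inv, le_div_iff₀ (by positivity)]
    linarith
  calc ‖c r‖ * (‖Φ y‖ * ‖Ψ z‖)
      ≤ (C * WW n r ^ s * (a⁻¹ * b⁻¹)) * ((C1 * pw n M y) * (C2 * pw n (M + L) z)) := by gcongr
    _ ≤ (C * ((1 + ‖ξ‖) ^ s * (1 + ‖z‖) ^ L) * (a⁻¹ * b⁻¹)) *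
        ((C1 * pw n M y) * (C2 * pw n (M + L) z)) := by gcongr
    _ = C * C1 * C2 * (1 + ‖ξ‖) ^ s * (a⁻¹ * b⁻¹) *
        (pw n M y * ((1 + ‖z‖) ^ L * pw n (M + L) z)) := by ring
    _ = C * C1 * C2 * (1 + ‖ξ‖) ^ s * (a⁻¹ * b⁻¹) * (pw n M y * pw n M z) := by rw [pw_add]
    _ ≤ C * C1 * C2 * (1 + ‖ξ‖) ^ s * (a⁻¹ * b⁻¹) *
        (((1 + (n : ℝ)) ^ M * pw n M (intVec n q.2.2.1)) *
          ((1 + (n : ℝ)) ^ M * pw n M (intVec n q.2.2.2))) := by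
        gcongr
        exact p1.trans k1
    _ = _ := by ring

/-- normalised coefficients -/
def cA (n : ℕ) (a : Ix n → ℂ) : Ix n → ℂ := fun q =>
  a q * (((2 : ℝ) ^ ((n * q.1 : ℝ) / 2) : ℝ) : ℂ) * (((2 : ℝ) ^ ((n * q.2.1 : ℝ) / 2) : ℝ) : ℂ)

lemma wterm2_eq (n : ℕ) (Φ Ψ : SchwartzMap (En n) ℂ) (a : Ix n → ℂ) (q : Ix n) :
    wterm2 n Φ Ψ a q = TT n (cc n (cA n a) 0 0) Φ Ψ q := by
  rw [cc_zero]
  funext X; simp only [wterm2, TT, cA]; ring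

lemma cA_bound (n : ℕ) (m ρ δ : ℝ) (a : Ix n → ℂ)
    (ha : ∀ α β : ℕ, ∃ C : ℝ, ∀ (j j' : ℕ) (k k' : Fin n → ℤ),
      ‖a (j, j', k, k')‖ ≤ C * (2 : ℝ) ^ ((-(n : ℝ) / 2 - α) * j) *
        (2 : ℝ) ^ ((-(n : ℝ) / 2 - β) * j') *
        (1 + (2 : ℝ) ^ (-(j' : ℝ)) * ‖intVec n k'‖) ^ (m + δ * α - ρ * β)) (A B : ℕ) :
    ∃ C : ℝ, 0 ≤ C ∧ ∀ q, ‖cA n a q‖ * ((2 : ℝ) ^ q.1) ^ A * ((2 : ℝ) ^ q.2.1) ^ B ≤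
      C * WW n q ^ (m + δ * A - ρ * B) := by
  obtain ⟨C, hC⟩ := ha A B
  refine ⟨|C|, abs_nonneg _, ?_⟩
  rintro ⟨j, j', k, k'⟩
  have h := hC j j' k k'
  have hW : (1 + (2 : ℝ) ^ (-(j' : ℝ)) * ‖intVec n k'‖) = WW n (j, j', k, k') := by
    simp only [WW]
    rw [Real.rpow_neg (by norm_num), Real.rpow_natCast]
  rw [hW] at h
  have hw : 0 ≤ WW n (j, j', k, k') ^ (m + δ * A - ρ * B) :=
    Real.rpow_nonneg (zero_le_one.trans (WW_one_le n _)) _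
  set w := WW n (j, j', k, k') ^ (m + δ * A - ρ * B)
  have key : ∀ (j A : ℕ), (2 : ℝ) ^ ((-(n : ℝ) / 2 - A) * j) *
      ((2 : ℝ) ^ ((n * j : ℝ) / 2) * ((2 : ℝ) ^ j) ^ A) = 1 := by
    intro j A
    rw [← pow_mul, ← Real.rpow_natCast, ← Real.rpow_add (by norm_num),
      ← Real.rpow_add (by norm_num)]
    rw [show (-(n : ℝ) / 2 - A) * j + ((n * j : ℝ) / 2 + ((j * A : ℕ) : ℝ)) = 0 by
      push_cast; ring, Real.rpow_zero]
  have e : ‖cA n a (j, j', k, k')‖ = ‖a (j, j', k, k')‖ * (2 : ℝ) ^ ((n * j : ℝ) / 2) *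
      (2 : ℝ) ^ ((n * j' : ℝ) / 2) := by
    simp only [cA, norm_mul, Complex.norm_real]
    rw [Real.norm_of_nonneg (by positivity), Real.norm_of_nonneg (by positivity)]
  rw [e]
  simp only
  have h' : ‖a (j, j', k, k')‖ ≤ |C| * (2 : ℝ) ^ ((-(n : ℝ) / 2 - A) * j) *
        (2 : ℝ) ^ ((-(n : ℝ) / 2 - B) * j') * w := by
    refine h.trans ?_
    gcongr
    exact le_abs_self C
  calc _ = ‖a (j, j', k, k')‖ * (((2 : ℝ) ^ ((n * j : ℝ) / 2) * ((2 : ℝ) ^ j) ^ A) *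
        ((2 : ℝ) ^ ((n * j' : ℝ) / 2) * ((2 : ℝ) ^ j') ^ B)) := by ring
    _ ≤ (|C| * (2 : ℝ) ^ ((-(n : ℝ) / 2 - A) * j) *
        (2 : ℝ) ^ ((-(n : ℝ) / 2 - B) * j') * w) *
        (((2 : ℝ) ^ ((n * j : ℝ) / 2) * ((2 : ℝ) ^ j) ^ A) *
        ((2 : ℝ) ^ ((n * j' : ℝ) / 2) * ((2 : ℝ) ^ j') ^ B)) := by gcongr
    _ = |C| * w * ((2 : ℝ) ^ ((-(n : ℝ) / 2 - A) * j) *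
      ((2 : ℝ) ^ ((n * j : ℝ) / 2) * ((2 : ℝ) ^ j) ^ A)) *
      ((2 : ℝ) ^ ((-(n : ℝ) / 2 - B) * j') *
      ((2 : ℝ) ^ ((n * j' : ℝ) / 2) * ((2 : ℝ) ^ j') ^ B)) := by ring
    _ = _ := by rw [key, key]; ring

lemma nice_cA (n : ℕ) (m ρ δ : ℝ) (hρ : 0 < ρ) (c : Ix n → ℂ)
    (h : ∀ A B : ℕ, ∃ C : ℝ, 0 ≤ C ∧ ∀ q, ‖c q‖ * ((2 : ℝ) ^ q.1) ^ A * ((2 : ℝ) ^ q.2.1) ^ B ≤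
      C * WW n q ^ (m + δ * A - ρ * B)) : Nice n c := by
  intro N
  obtain ⟨B0, hB0⟩ := exists_nat_ge ((m + δ * N) / ρ)
  rw [div_le_iff₀ hρ] at hB0
  obtain ⟨C, hC0, hC⟩ := h N (N + B0)
  refine ⟨C, hC0, fun q => ?_⟩
  have h1 : (1 : ℝ) ≤ 2 ^ q.2.1 := one_le_pow₀ (by norm_num)
  calc _ ≤ ‖c q‖ * ((2 : ℝ) ^ q.1) ^ N * ((2 : ℝ) ^ q.2.1) ^ (N + B0) := by
        gcongr
        omega
    _ ≤ _ := hC q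
    _ ≤ C * 1 := by
        gcongr
        refine Real.rpow_le_one_of_one_le_of_nonpos (WW_one_le n q) ?_
        push_cast
        have : 0 ≤ ρ * N := by positivity
        nlinarith
    _ = C := mul_one C

/-- If `ρ > 0`, `δ ≥ 0` and the coefficients satisfy
`|a_{j,j′,k,k′}| ≤ C_{α,β} 2^{−(n/2+α)j} 2^{−(n/2+β)j′} (1+2^{−j′}|k′|)^{m+δα−ρβ}` for all
`α, β ∈ ℕ`, then the series `σ = ∑ a_{j,j′,k,k′} 2^{nj/2} Φ(2^j x−k) 2^{nj′/2} Ψ(2^{j′} ξ−k′)`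
converges absolutely, together with all its termwise derivatives, to a smooth symbol
`σ ∈ S^m_{ρ,δ}`. -/
theorem stmt_17 (n : ℕ) (hn : 1 ≤ n) (m ρ δ : ℝ) (hρ : 0 < ρ) (hδ : 0 ≤ δ)
    (Φ Ψ : SchwartzMap (En n) ℂ)
    (a : ℕ × ℕ × (Fin n → ℤ) × (Fin n → ℤ) → ℂ)
    (ha : ∀ α β : ℕ, ∃ C : ℝ, ∀ (j j' : ℕ) (k k' : Fin n → ℤ),
      ‖a (j, j', k, k')‖ ≤ C * (2 : ℝ) ^ ((-(n : ℝ) / 2 - α) * j) *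
        (2 : ℝ) ^ ((-(n : ℝ) / 2 - β) * j') *
        (1 + (2 : ℝ) ^ (-(j' : ℝ)) * ‖intVec n k'‖) ^ (m + δ * α - ρ * β)) :
    ∃ σ : En n × En n → ℂ,
      (∀ (α β : Fin n → ℕ) (X : En n × En n),
        Summable fun q : ℕ × ℕ × (Fin n → ℤ) × (Fin n → ℤ) =>
          ‖mixD n α β (wterm2 n Φ Ψ a q) X‖) ∧
      (∀ (α β : Fin n → ℕ) (X : En n × En n),
        HasSum (fun q : ℕ × ℕ × (Fin n → ℤ) × (Fin n → ℤ) =>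
          mixD n α β (wterm2 n Φ Ψ a q) X) (mixD n α β σ X)) ∧
      IsHormander n m ρ δ σ := by
  set c := cA n a with hc
  have hb := cA_bound n m ρ δ a ha
  have hnice : Nice n c := nice_cA n m ρ δ hρ c hb
  have hT : ∀ (α β : Fin n → ℕ) (q : Ix n), mixD n α β (wterm2 n Φ Ψ a q) =
      TT n (cc n c (∑ i, α i) (∑ i, β i)) (dL (dirList α (unitE n)) Φ)
        (dL (dirList β (unitE n)) Ψ) q := by
    intro α β q
    unfold mixD
    rw [dirList_map α (unitE n) (fun v => (v, (0 : En n))),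
      dirList_map β (unitE n) (fun v => ((0 : En n), v)), wterm2_eq, pdSeq_TT,
      dirList_length, dirList_length]
  have hS : ∀ (α β : Fin n → ℕ), mixD n α β (SS n (cc n c 0 0) Φ Ψ) =
      SS n (cc n c (∑ i, α i) (∑ i, β i)) (dL (dirList α (unitE n)) Φ)
        (dL (dirList β (unitE n)) Ψ) := by
    intro α β
    unfold mixD
    rw [dirList_map α (unitE n) (fun v => (v, (0 : En n))),
      dirList_map β (unitE n) (fun v => ((0 : En n), v)), pdSeq_SS n hnice,
      dirList_length, dirList_length]
  refine ⟨SS n (cc n c 0 0) Φ Ψ, ?_, ?_, ?_, ?_⟩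
  · intro α β X
    simp_rw [hT]
    exact summable_TT_norm n (nice_cc n hnice _ _) _ _ X
  · intro α β X
    simp_rw [hT, hS]
    exact (summable_TT_norm n (nice_cc n hnice _ _) _ _ X).of_norm.hasSum
  · exact contDiff_infty.mpr fun N => contDiff_SS n N (nice_cc n hnice 0 0) Φ Ψ
  · intro α β
    rw [hS]
    set A := ∑ i, α i with hA
    set B := ∑ i, β i with hB
    have eA : ∑ i, (α i : ℝ) = (A : ℝ) := by rw [hA]; push_cast; rfl
    have eB : ∑ i, (β i : ℝ) = (B : ℝ) := by rw [hB]; push_cast; rfl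
    rw [eA, eB]
    obtain ⟨N, hN⟩ := exists_nat_ge (δ / ρ)
    rw [div_le_iff₀ hρ] at hN
    obtain ⟨C, hC0, hC⟩ := hb (A + 1) (B + (N + 1))
    refine global_bound n _ _ _ C _ hC0 fun q => ?_
    have h1 : (1 : ℝ) ≤ 2 ^ q.2.1 := one_le_pow₀ (by norm_num)
    have e : ‖cc n c A B q‖ = ‖c q‖ * ((2 : ℝ) ^ q.1) ^ A * ((2 : ℝ) ^ q.2.1) ^ B := by
      simp [cc]
    calc _ = ‖c q‖ * ((2 : ℝ) ^ q.1) ^ (A + 1) * ((2 : ℝ) ^ q.2.1) ^ (B + 1) := by rw [e]; ring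
      _ ≤ ‖c q‖ * ((2 : ℝ) ^ q.1) ^ (A + 1) * ((2 : ℝ) ^ q.2.1) ^ (B + (N + 1)) := by
        gcongr
        omega
      _ ≤ _ := hC q
      _ ≤ _ := by
        gcongr
        · exact WW_one_le n q
        · push_cast
          nlinarith
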